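/- The family of simple 2-matchings of the complete graph K_n is a 2-extendible system: for every 2-matching B, every A ⊆ B, and every edge x ∉ A such that A ∪ {x} is a 2-matching, there exists C ⊆ B \ A with |C| ≤ 2 such that (B \ C) ∪ {x} is a 2-matching. -/

import Mathlib

/-- Degree of a vertex in an edge set. -/
def degIn {V : Type*} [DecidableEq V] (S : Finset (Sym2 V)) (v : V) : ℕ :=
  (S.filter (fun e => v ∈ e)).card

/-- A simple 2-matching of the complete graph on `V`: a set of non-loop edges in which
every vertex has degree at most `2`. -/
def Matching2 {V : Type*} [DecidableEq V] (S : Finset (Sym2 V)) : Prop :=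
  (∀ e ∈ S, ¬ e.IsDiag) ∧ (∀ v : V, degIn S v ≤ 2)

theorem degIn_mono {V : Type*} [DecidableEq V] {S T : Finset (Sym2 V)} (h : S ⊆ T) (v : V) :
    degIn S v ≤ degIn T v :=
  Finset.card_le_card (Finset.filter_subset_filter _ h)

theorem degIn_insert_of_notMem {V : Type*} [DecidableEq V] (S : Finset (Sym2 V)) {x : Sym2 V}
    {v : V} (hv : v ∉ x) : degIn (insert x S) v = degIn S v := by
  simp [degIn, Finset.filter_insert, hv]

theorem degIn_insert_le {V : Type*} [DecidableEq V] (S : Finset (Sym2 V)) (x : Sym2 V) (v : V) :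
    degIn (insert x S) v ≤ degIn S v + 1 := by
  by_cases hv : v ∈ x
  · simpa [degIn, Finset.filter_insert, hv] using Finset.card_insert_le x (S.filter (v ∈ ·))
  · simp [degIn_insert_of_notMem S hv]

theorem degIn_insert_of_mem {V : Type*} [DecidableEq V] {S : Finset (Sym2 V)} {x : Sym2 V}
    {v : V} (hv : v ∈ x) (hx : x ∉ S) : degIn (insert x S) v = degIn S v + 1 := by
  simp [degIn, Finset.filter_insert, hv, hx]

/-- If `v` has smaller degree in `A` than the bound `k + 1` on its degree in `B`, then removing at
most one edge of `B \ A` brings its degree in `B` down to `k`. -/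
theorem exists_subset_sdiff_degIn_le {V : Type*} [DecidableEq V] {A B : Finset (Sym2 V)} {v : V}
    {k : ℕ} (hA : degIn A v ≤ k) (hB : degIn B v ≤ k + 1) :
    ∃ C ⊆ B \ A, C.card ≤ 1 ∧ degIn (B \ C) v ≤ k := by
  by_cases hk : degIn B v ≤ k
  · exact ⟨∅, by simp, by simp, by simpa using hk⟩
  obtain ⟨e, heB, heA⟩ : ∃ e ∈ B.filter (v ∈ ·), e ∉ A.filter (v ∈ ·) :=
    Finset.exists_mem_notMem_of_card_lt_card (hA.trans_lt (not_le.mp hk))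
  rw [Finset.mem_filter] at heB heA
  have h : degIn (insert e (B \ {e})) v = degIn (B \ {e}) v + 1 :=
    degIn_insert_of_mem heB.2 (by simp)
  rw [Finset.sdiff_singleton_eq_erase, Finset.insert_erase heB.1] at h
  refine ⟨{e}, ?_, by simp, ?_⟩
  · simpa using ⟨heB.1, fun he => heA ⟨he, heB.2⟩⟩
  · rw [Finset.sdiff_singleton_eq_erase]
    omega

/-- The family of simple 2-matchings of `K_n` is 2-extendible. -/
theorem matching2_two_extendible {V : Type*} [Fintype V] [DecidableEq V]
    (B A : Finset (Sym2 V)) (x : Sym2 V)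
    (hB : Matching2 B) (hAB : A ⊆ B) (hx : ¬ x.IsDiag) (hxA : x ∉ A)
    (hAx : Matching2 (insert x A)) :
    ∃ C ⊆ B \ A, C.card ≤ 2 ∧ Matching2 (insert x (B \ C)) := by
  induction x with | _ a b
  have hA : ∀ v ∈ s(a, b), degIn A v ≤ 1 := fun v hv => by
    have := hAx.2 v
    rw [degIn_insert_of_mem hv hxA] at this
    omega
  obtain ⟨C, hC, hC_card, hCa⟩ :=
    exists_subset_sdiff_degIn_le (hA a (Sym2.mem_mk_left a b)) (hB.2 a)
  obtain ⟨D, hD, hD_card, hDb⟩ :=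
    exists_subset_sdiff_degIn_le (hA b (Sym2.mem_mk_right a b)) (hB.2 b)
  refine ⟨C ∪ D, Finset.union_subset hC hD, (Finset.card_union_le C D).trans (by omega), ?_, ?_⟩
  · intro e he
    rcases Finset.mem_insert.mp he with rfl | he
    · exact hx
    · exact hB.1 e (Finset.mem_sdiff.mp he).1
  · intro v
    by_cases hv : v ∈ s(a, b)
    · refine (degIn_insert_le _ _ v).trans (Nat.succ_le_succ ?_)
      rcases Sym2.mem_iff.mp hv with rfl | rfl
      · exact (degIn_mono (Finset.sdiff_subset_sdiff le_rfl Finset.subset_union_left) v).trans hCa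
      · exact (degIn_mono (Finset.sdiff_subset_sdiff le_rfl Finset.subset_union_right) v).trans hDb
    · rw [degIn_insert_of_notMem _ hv]
      exact (degIn_mono Finset.sdiff_subset v).trans (hB.2 v)
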